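/- arXiv:1201.3467 — 4 statements merged into one kernel-verified Lean document; each statement's English description precedes it below -/
import Mathlib

section
/- Let S ⊆ ℝⁿ be an open convex set and let g : S → ℝⁿ be differentiable on S. Suppose that for every x ∈ S the Jacobian matrix J(x) of g at x has negative definite symmetric part, i.e. zᵀ(J(x) + J(x)ᵀ)z < 0 for every nonzero z ∈ ℝⁿ. Then for all distinct points x, y ∈ S one has (y − x)ᵀ g(x) + (x − y)ᵀ g(y) > 0. -/
open scoped RealInnerProductSpace Matrix

/-- The quadratic form of `A + Aᵀ` is twice that of `A`. -/
theorem dotProduct_add_transpose_mulVec {ι R : Type*} [Fintype ι] [CommSemiring R]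
    (A : Matrix ι ι R) (z : ι → R) :
    z ⬝ᵥ ((A + Aᵀ) *ᵥ z) = 2 * (z ⬝ᵥ (A *ᵥ z)) := by
  rw [Matrix.add_mulVec, dotProduct_add, Matrix.mulVec_transpose, dotProduct_comm z (z ᵥ* A),
    ← Matrix.dotProduct_mulVec, two_mul]

/-- Mean value form of strict monotonicity: a vector field on a convex set whose derivative has a
negative definite quadratic form is strictly decreasing along segments. -/
theorem inner_sub_sub_neg_of_fderiv_neg {E : Type*} [NormedAddCommGroup E] [InnerProductSpace ℝ E]
    {S : Set E} (hS : Convex ℝ S) {g : E → E} {g' : E → E →L[ℝ] E}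
    (hg : ∀ x ∈ S, HasFDerivWithinAt g (g' x) S x)
    (hneg : ∀ x ∈ S, ∀ v : E, v ≠ 0 → ⟪v, g' x v⟫ < 0)
    {x y : E} (hx : x ∈ S) (hy : y ∈ S) (hxy : x ≠ y) :
    ⟪y - x, g y - g x⟫ < 0 := by
  obtain ⟨z, hz, h⟩ := domain_mvt
    (fun w hw => (innerSL ℝ (y - x)).hasFDerivAt.comp_hasFDerivWithinAt w (hg w hw)) hS hx hy
  have hv := hneg z (hS.segment_subset hx hy hz) (y - x) (sub_ne_zero.2 hxy.symm)
  simp only [Function.comp_apply, innerSL_apply_apply, ContinuousLinearMap.comp_apply] at h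
  rwa [inner_sub_right, h]

/-- If a differentiable vector field `g` on an open convex set `S ⊆ ℝⁿ` has a Jacobian
`J x` whose symmetric part is negative definite at every point of `S`, then `g` is
diagonally strictly concave: `(y − x)ᵀ g(x) + (x − y)ᵀ g(y) > 0` for distinct `x, y ∈ S`. -/
theorem stmt_2 {n : ℕ}
    (S : Set (EuclideanSpace ℝ (Fin n)))
    (hSopen : IsOpen S) (hSconv : Convex ℝ S)
    (g : EuclideanSpace ℝ (Fin n) → EuclideanSpace ℝ (Fin n))
    (J : EuclideanSpace ℝ (Fin n) → Matrix (Fin n) (Fin n) ℝ)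
    (hderiv : ∀ x ∈ S, HasFDerivAt g (Matrix.toEuclideanCLM (𝕜 := ℝ) (J x)) x)
    (hnegdef : ∀ x ∈ S, ∀ z : Fin n → ℝ, z ≠ 0 → z ⬝ᵥ ((J x + (J x)ᵀ) *ᵥ z) < 0) :
    ∀ x ∈ S, ∀ y ∈ S, x ≠ y → 0 < ⟪y - x, g x⟫ + ⟪x - y, g y⟫ := by
  intro x hx y hy hxy
  have hneg : ∀ x ∈ S, ∀ v, v ≠ 0 → ⟪v, Matrix.toEuclideanCLM (𝕜 := ℝ) (J x) v⟫ < 0 := by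
    intro x hx v hv
    have h := hnegdef x hx v.ofLp (by simpa using hv)
    rw [dotProduct_add_transpose_mulVec] at h
    rw [Matrix.inner_toEuclideanCLM]
    linarith
  have h := inner_sub_sub_neg_of_fderiv_neg hSconv
    (fun w hw => (hderiv w hw).hasFDerivWithinAt) hneg hx hy hxy
  rw [← neg_sub y x, inner_neg_left]
  rw [inner_sub_right] at h
  linarith
end

section
/- Consider a strategic form game with finitely many players i = 1,…,I, where player i's strategy set S_i is a convex subset of ℝ^{m_i} and the payoff functions u_i : S → ℝ (with S = ∏_i S_i) are differentiable, and each u_i(·, x_{−i}) is concave in x_i for every fixed x_{−i}. Define the pseudo-gradient g : S → ℝ^{m₁+…+m_I} by stacking the partial gradients g(x) = (∇₁u₁(x), …, ∇_I u_I(x)). If the payoffs are diagonally strictly concave, i.e. (x̂ − x*)ᵀ g(x*) + (x* − x̂)ᵀ g(x̂) > 0 for all distinct x*, x̂ ∈ S, then the game has at most one pure strategy Nash equilibrium. -/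
open scoped RealInnerProductSpace

/-- At a maximum over a convex set, the gradient has nonpositive inner product with every
feasible direction. -/
theorem IsMaxOn.inner_gradient_nonpos {E : Type*} [NormedAddCommGroup E] [InnerProductSpace ℝ E]
    [CompleteSpace E] {S : Set E} {f : E → ℝ} {a b v : E} (hmax : IsMaxOn f S a)
    (hS : Convex ℝ S) (hf : HasGradientAt f v a) (ha : a ∈ S) (hb : b ∈ S) :
    ⟪b - a, v⟫ ≤ 0 := by
  have h := hmax.localize.hasFDerivWithinAt_nonpos hf.hasFDerivAt.hasFDerivWithinAt
    (sub_mem_posTangentConeAt_of_segment_subset (hS.segment_subset ha hb))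
  rwa [InnerProductSpace.toDual_apply_apply, real_inner_comm] at h

/-- In a concave game whose pseudo-gradient is diagonally strictly concave, there is at
most one pure strategy Nash equilibrium. -/
theorem stmt_3 {I : ℕ} (m : Fin I → ℕ)
    (Si : ∀ i : Fin I, Set (EuclideanSpace ℝ (Fin (m i))))
    (hSconv : ∀ i, Convex ℝ (Si i))
    (u : Fin I → (∀ i : Fin I, EuclideanSpace ℝ (Fin (m i))) → ℝ)
    (g : (∀ i : Fin I, EuclideanSpace ℝ (Fin (m i))) →
         ∀ i : Fin I, EuclideanSpace ℝ (Fin (m i)))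
    (hdiff : ∀ (i : Fin I) (x : ∀ i : Fin I, EuclideanSpace ℝ (Fin (m i))),
        HasGradientAt (fun y => u i (Function.update x i y)) (g x i) (x i))
    (hconc : ∀ (i : Fin I) (x : ∀ i : Fin I, EuclideanSpace ℝ (Fin (m i))),
        ConcaveOn ℝ (Si i) (fun y => u i (Function.update x i y)))
    (hdsc : ∀ x y : ∀ i : Fin I, EuclideanSpace ℝ (Fin (m i)),
        (∀ i, x i ∈ Si i) → (∀ i, y i ∈ Si i) → x ≠ y →
        0 < ∑ i, (⟪y i - x i, g x i⟫ + ⟪x i - y i, g y i⟫)) :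
    ∀ s t : ∀ i : Fin I, EuclideanSpace ℝ (Fin (m i)),
      ((∀ i, s i ∈ Si i) ∧ ∀ i, ∀ y ∈ Si i, u i (Function.update s i y) ≤ u i s) →
      ((∀ i, t i ∈ Si i) ∧ ∀ i, ∀ y ∈ Si i, u i (Function.update t i y) ≤ u i t) →
      s = t := by
  rintro s t ⟨hs, hs_max⟩ ⟨ht, ht_max⟩
  by_contra hne
  refine (hdsc s t hs ht hne).not_ge (Finset.sum_nonpos fun i _ => add_nonpos ?_ ?_)
  · refine IsMaxOn.inner_gradient_nonpos (fun y hy => ?_) (hSconv i) (hdiff i s) (hs i) (ht i)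
    simpa using hs_max i y hy
  · refine IsMaxOn.inner_gradient_nonpos (fun y hy => ?_) (hSconv i) (hdiff i t) (ht i) (hs i)
    simpa using ht_max i y hy
end

section
/- Let M be a real n×n matrix all of whose principal minors are positive (a P-matrix). Then for every vector q ∈ ℝⁿ, the linear complementarity problem LCP(M, q) has exactly one solution. -/
open scoped Matrix

/-- `M` is a P-matrix: every principal minor is positive. -/
def IsPMatrix {n : ℕ} (M : Matrix (Fin n) (Fin n) ℝ) : Prop :=
  ∀ J : Finset (Fin n), J.Nonempty →
    0 < (M.submatrix (fun j : J => (j : Fin n)) (fun j : J => (j : Fin n))).det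

/-- `x` solves the linear complementarity problem `LCP(M, q)`. -/
def IsLCPSol {n : ℕ} (M : Matrix (Fin n) (Fin n) ℝ) (q x : Fin n → ℝ) : Prop :=
  (∀ i, 0 ≤ x i) ∧ (∀ i, 0 ≤ (M *ᵥ x + q) i) ∧ x ⬝ᵥ (M *ᵥ x + q) = 0

namespace IsPMatrix

variable {n : ℕ} {M : Matrix (Fin n) (Fin n) ℝ}

/-- Replacing some rows of a P-matrix by the corresponding rows of the identity keeps the
determinant positive. -/
theorem det_piecewise_one_pos (hM : IsPMatrix M) (S : Finset (Fin n)) :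
    0 < Matrix.det (Matrix.of fun i j => if i ∈ S then M i j else
      (1 : Matrix (Fin n) (Fin n) ℝ) i j) := by
  rw [Matrix.twoBlockTriangular_det _ (fun i => i ∈ S) (by
    intro i hi j hj
    rw [Matrix.of_apply, if_neg hi]
    exact Matrix.one_apply_ne (fun h => hi (h ▸ hj)))]
  have h₁ : Matrix.toSquareBlockProp (Matrix.of fun i j => if i ∈ S then M i j else
      (1 : Matrix (Fin n) (Fin n) ℝ) i j)
      (fun i => i ∉ S) = 1 := by
    ext i j
    simp [Matrix.toSquareBlockProp_def, i.2, Matrix.one_apply, Subtype.ext_iff]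
  have h₂ : Matrix.toSquareBlockProp (Matrix.of fun i j => if i ∈ S then M i j else
      (1 : Matrix (Fin n) (Fin n) ℝ) i j)
      (fun i => i ∈ S) = M.submatrix (fun j : S => (j : Fin n)) (fun j : S => (j : Fin n)) := by
    ext i j
    simp [Matrix.toSquareBlockProp_def]
  rw [h₁, h₂, Matrix.det_one, mul_one]
  rcases S.eq_empty_or_nonempty with rfl | hS
  · simp
  · convert hM S hS

/-- Nonnegative, nowhere simultaneously vanishing row combinations of a P-matrix and the identity
have positive determinant. -/
theorem det_diagonal_mul_add_diagonal_pos (hM : IsPMatrix M) {a b : Fin n → ℝ}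
    (ha : ∀ i, 0 ≤ a i) (hb : ∀ i, 0 ≤ b i) (hab : ∀ i, a i ≠ 0 ∨ b i ≠ 0) :
    0 < (Matrix.diagonal a * M + Matrix.diagonal b).det := by
  have hexp : (Matrix.diagonal a * M + Matrix.diagonal b).det =
      ∑ S : Finset (Fin n), (∏ i, S.piecewise a b i) *
        Matrix.det (Matrix.of fun i j => if i ∈ S then M i j else
          (1 : Matrix (Fin n) (Fin n) ℝ) i j) := by
    have hadd := (Matrix.detRowAlternating (n := Fin n) (R := ℝ)).toMultilinearMap.map_add_univ
      (Matrix.diagonal a * M) (Matrix.diagonal b)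
    refine hadd.trans (Finset.sum_congr rfl fun S _ => ?_)
    rw [← Matrix.det_mul_column]
    refine congrArg Matrix.det (Matrix.ext fun i j => ?_)
    by_cases hi : i ∈ S
    · simp [Finset.piecewise, hi]
    · simp [Finset.piecewise, hi, Matrix.one_apply, Matrix.diagonal_apply]
  rw [hexp]
  have hnonneg : ∀ S : Finset (Fin n), ∀ i, 0 ≤ S.piecewise a b i := by
    intro S i
    by_cases hi : i ∈ S <;> simp [hi, ha, hb]
  refine Finset.sum_pos' (fun S _ => mul_nonneg (Finset.prod_nonneg fun i _ => hnonneg S i)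
    (hM.det_piecewise_one_pos S).le) ⟨Finset.univ.filter fun i => a i ≠ 0, Finset.mem_univ _,
      mul_pos (Finset.prod_pos fun i _ => (hnonneg _ i).lt_of_ne' ?_)
        (hM.det_piecewise_one_pos _)⟩
  by_cases hi : a i = 0
  · simpa [Finset.piecewise, hi] using hab i
  · simp [Finset.piecewise, hi]

/-- A P-matrix reverses the sign of no nonzero vector. -/
theorem exists_pos_mul_mulVec (hM : IsPMatrix M) {z : Fin n → ℝ} (hz : z ≠ 0) :
    ∃ i, 0 < z i * (M *ᵥ z) i := by
  by_contra! h
  refine (hM.det_diagonal_mul_add_diagonal_pos (a := fun i => |z i|)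
    (b := fun i => if z i = 0 then 1 else |(M *ᵥ z) i|) (fun i => abs_nonneg _) (fun i => ?_)
    (fun i => ?_)).ne' (Matrix.exists_mulVec_eq_zero_iff.mp ⟨z, hz, ?_⟩)
  · split_ifs <;> positivity
  · by_cases hi : z i = 0 <;> simp [hi]
  · ext i
    rw [Matrix.add_mulVec, ← Matrix.mulVec_mulVec, Pi.add_apply, Matrix.mulVec_diagonal,
      Matrix.mulVec_diagonal, Pi.zero_apply]
    have hi := h i
    rcases lt_trichotomy (z i) 0 with hzi | hzi | hzi
    · have : 0 ≤ (M *ᵥ z) i := by nlinarith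
      rw [if_neg hzi.ne, abs_of_neg hzi, abs_of_nonneg this]
      ring
    · simp [hzi]
    · have : (M *ᵥ z) i ≤ 0 := by nlinarith
      rw [if_neg hzi.ne', abs_of_pos hzi, abs_of_nonpos this]
      ring

/-- A quantitative form of `IsPMatrix.exists_pos_mul_mulVec`. -/
theorem exists_mul_norm_sq_le (hM : IsPMatrix M) :
    ∃ c : ℝ, 0 < c ∧ ∀ (z : Fin n → ℝ) (k : Fin n), (∀ i, i ≠ k → z i * (M *ᵥ z) i ≤ 0) →
      c * ‖z‖ ^ 2 ≤ z k * (M *ᵥ z) k := by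
  have hcont : ∀ k, Continuous fun z : Fin n → ℝ => z k * (M *ᵥ z) k := fun k =>
    (continuous_apply k).mul
      ((continuous_apply k).comp (continuous_const.matrix_mulVec continuous_id))
  have hk : ∀ k : Fin n, ∃ c : ℝ, 0 < c ∧ ∀ z : Fin n → ℝ,
      (∀ i, i ≠ k → z i * (M *ᵥ z) i ≤ 0) → c * ‖z‖ ^ 2 ≤ z k * (M *ᵥ z) k := by
    intro k
    have hcomp : IsCompact (Metric.sphere (0 : Fin n → ℝ) 1 ∩
        {z | ∀ i, i ≠ k → z i * (M *ᵥ z) i ≤ 0}) := by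
      refine (isCompact_sphere 0 1).inter_right ?_
      simp only [Set.ofPred_forall]
      exact isClosed_iInter fun i => isClosed_iInter fun _ =>
        isClosed_le (hcont i) continuous_const
    obtain ⟨c, hc, hle⟩ := hcomp.exists_forall_le' (hcont k).continuousOn (a := 0) (by
      rintro z ⟨hz, hneg⟩
      obtain ⟨i, hi⟩ := hM.exists_pos_mul_mulVec (z := z) (by
        rintro rfl
        simp at hz)
      by_cases hik : i = k
      · exact hik ▸ hi
      · exact absurd hi (hneg i hik).not_gt)
    refine ⟨c, hc, fun z hz => ?_⟩
    rcases eq_or_ne z 0 with rfl | hz0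
    · simp
    have hpos : 0 < ‖z‖ := norm_pos_iff.mpr hz0
    have hscale : ∀ i, (‖z‖⁻¹ • z) i * (M *ᵥ (‖z‖⁻¹ • z)) i =
        (‖z‖⁻¹) ^ 2 * (z i * (M *ᵥ z) i) := by
      intro i
      rw [Matrix.mulVec_smul]
      simp only [Pi.smul_apply, smul_eq_mul]
      ring
    have h := hle (‖z‖⁻¹ • z) ⟨by simp [norm_smul, hpos.ne'], fun i hi => by
      rw [hscale]
      exact mul_nonpos_of_nonneg_of_nonpos (by positivity) (hz i hi)⟩
    rw [hscale, inv_pow, ← div_eq_inv_mul, le_div_iff₀ (by positivity)] at h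
    exact h
  choose c hc hle using hk
  rcases isEmpty_or_nonempty (Fin n) with hn | hn
  · exact ⟨1, one_pos, fun _ k => isEmptyElim k⟩
  · obtain ⟨k₀, hk₀⟩ := Finite.exists_min c
    exact ⟨c k₀, hc k₀, fun z k hz =>
      (mul_le_mul_of_nonneg_right (hk₀ k) (by positivity)).trans (hle k z hz)⟩

end IsPMatrix

/-- Two complementary pairs of nonnegative reals vary in opposite directions. -/
theorem sub_mul_sub_nonpos_of_complementary {x y u v : ℝ} (hx : 0 ≤ x) (hy : 0 ≤ y) (hu : 0 ≤ u)
    (hv : 0 ≤ v) (hxu : x * u = 0) (hyv : y * v = 0) : (x - y) * (u - v) ≤ 0 := by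
  nlinarith [mul_nonneg hx hv, mul_nonneg hy hu]

/-- For a P-matrix, the complementarity conditions can be solved on any set of coordinates, with
the remaining coordinates prescribed. -/
theorem IsPMatrix.exists_partial_lcpSol {n : ℕ} {M : Matrix (Fin n) (Fin n) ℝ} (hM : IsPMatrix M)
    (q : Fin n → ℝ) (K : Finset (Fin n)) (y : Fin n → ℝ) :
    ∃ x : Fin n → ℝ, (∀ i, i ∉ K → x i = y i) ∧
      ∀ i ∈ K, 0 ≤ x i ∧ 0 ≤ (M *ᵥ x + q) i ∧ x i * (M *ᵥ x + q) i = 0 := by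
  obtain ⟨c, hc, hcle⟩ := hM.exists_mul_norm_sq_le
  induction K using Finset.induction_on generalizing y with
  | empty => exact ⟨y, by simp, by simp⟩
  | insert k K hk ih =>
    choose X hXout hX using fun t : ℝ => ih (Function.update y k t)
    have hXk : ∀ t, X t k = t := fun t => by simp [hXout t k hk]
    have hXo : ∀ t i, i ∉ insert k K → X t i = y i := by
      intro t i hi
      rw [Finset.mem_insert, not_or] at hi
      rw [hXout t i hi.2, Function.update_of_ne hi.1]
    set w : ℝ → ℝ := fun t => (M *ᵥ X t + q) k with hw
    have hsub : ∀ s t i, (M *ᵥ (X s - X t)) i = (M *ᵥ X s + q) i - (M *ᵥ X t + q) i := by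
      intro s t i
      simp [Matrix.mulVec_sub]
    have hmono : ∀ s t, c * ‖X s - X t‖ ^ 2 ≤ (s - t) * (w s - w t) := by
      intro s t
      have h := hcle (X s - X t) k fun i hik => by
        by_cases hi : i ∈ K
        · obtain ⟨h₁, h₂, h₃⟩ := hX s i hi
          obtain ⟨h₄, h₅, h₆⟩ := hX t i hi
          rw [hsub]
          exact sub_mul_sub_nonpos_of_complementary h₁ h₄ h₂ h₅ h₃ h₆
        · have hi' : i ∉ insert k K := by simp [hik, hi]
          simp [hXo _ i hi']
      rwa [hsub, Pi.sub_apply, hXk, hXk] at h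
    have hdist : ∀ s t, |s - t| ≤ ‖X s - X t‖ := by
      intro s t
      simpa [hXk] using norm_le_pi_norm (X s - X t) k
    set A := LinearMap.toContinuousLinearMap M.mulVecLin with hA
    have hwle : ∀ s t, |w s - w t| ≤ ‖A‖ * ‖X s - X t‖ := by
      intro s t
      have h := (norm_le_pi_norm (A (X s - X t)) k).trans (A.le_opNorm _)
      have hAk : A (X s - X t) k = w s - w t := hsub s t k
      rwa [hAk, Real.norm_eq_abs] at h
    have hlip : ∀ s t, |w s - w t| ≤ ‖A‖ ^ 2 / c * |s - t| := by
      intro s t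
      rcases eq_or_ne s t with rfl | hst
      · simp
      have hpos : 0 < ‖X s - X t‖ := (abs_pos.mpr (sub_ne_zero.mpr hst)).trans_le (hdist s t)
      have h₁ : c * ‖X s - X t‖ ^ 2 ≤ |s - t| * (‖A‖ * ‖X s - X t‖) :=
        (hmono s t).trans ((le_abs_self _).trans ((abs_mul _ _).le.trans
          (mul_le_mul_of_nonneg_left (hwle s t) (abs_nonneg _))))
      have h₂ : c * ‖X s - X t‖ ≤ |s - t| * ‖A‖ := by
        refine le_of_mul_le_mul_right ?_ hpos
        linarith
      refine (hwle s t).trans ?_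
      rw [div_mul_eq_mul_div, le_div_iff₀ hc]
      nlinarith [mul_le_mul_of_nonneg_left h₂ (norm_nonneg A)]
    have hcont : Continuous w := by
      refine (LipschitzWith.of_dist_le_mul (K := Real.toNNReal (‖A‖ ^ 2 / c))
        fun s t => ?_).continuous
      rw [Real.coe_toNNReal _ (by positivity), Real.dist_eq, Real.dist_eq]
      exact hlip s t
    obtain ⟨t, ht, hwt, htw⟩ : ∃ t, 0 ≤ t ∧ 0 ≤ w t ∧ t * w t = 0 := by
      rcases le_or_gt 0 (w 0) with h0 | h0
      · exact ⟨0, le_rfl, h0, zero_mul _⟩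
      have hT : 0 < -w 0 / c := div_pos (neg_pos.mpr h0) hc
      have hwT : 0 ≤ w (-w 0 / c) := by
        set T := -w 0 / c with hTdef
        have hcT : c * T = -w 0 := by rw [hTdef]; field_simp
        have h₁ : T ≤ ‖X T - X 0‖ := by simpa [abs_of_pos hT] using hdist T 0
        have h₂ : c * T ^ 2 ≤ T * (w T - w 0) := by
          have := hmono T 0
          rw [sub_zero] at this
          exact (mul_le_mul_of_nonneg_left (pow_le_pow_left₀ hT.le h₁ 2) hc.le).trans this
        have h₃ : c * T ≤ w T - w 0 := by
          refine le_of_mul_le_mul_left ?_ hT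
          linarith
        linarith
      obtain ⟨t, ht, hwt⟩ := intermediate_value_Icc hT.le hcont.continuousOn ⟨h0.le, hwT⟩
      exact ⟨t, ht.1, hwt.ge, by rw [hwt, mul_zero]⟩
    refine ⟨X t, hXo t, fun i hi => ?_⟩
    rcases Finset.mem_insert.mp hi with rfl | hi
    · rw [hXk]
      exact ⟨ht, hwt, htw⟩
    · exact hX t i hi

theorem IsLCPSol.mul_eq_zero {n : ℕ} {M : Matrix (Fin n) (Fin n) ℝ} {q x : Fin n → ℝ}
    (h : IsLCPSol M q x) (i : Fin n) : x i * (M *ᵥ x + q) i = 0 :=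
  (Finset.sum_eq_zero_iff_of_nonneg fun i _ => mul_nonneg (h.1 i) (h.2.1 i)).mp h.2.2 i
    (Finset.mem_univ i)

/-- If `M` is a P-matrix, then for every `q` the problem `LCP(M, q)` has exactly one
solution. -/
theorem stmt_5 {n : ℕ} (M : Matrix (Fin n) (Fin n) ℝ) (hM : IsPMatrix M) :
    ∀ q : Fin n → ℝ, ∃! x : Fin n → ℝ, IsLCPSol M q x := by
  intro q
  obtain ⟨x, -, hx⟩ := hM.exists_partial_lcpSol q Finset.univ 0
  have hsol : IsLCPSol M q x := ⟨fun i => (hx i (Finset.mem_univ i)).1,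
    fun i => (hx i (Finset.mem_univ i)).2.1,
    Finset.sum_eq_zero fun i hi => (hx i hi).2.2⟩
  refine ⟨x, hsol, fun y hy => ?_⟩
  by_contra hne
  obtain ⟨i, hi⟩ := hM.exists_pos_mul_mulVec (sub_ne_zero.mpr hne)
  have hsub : (M *ᵥ (y - x)) i = (M *ᵥ y + q) i - (M *ᵥ x + q) i := by
    simp [Matrix.mulVec_sub]
  rw [hsub] at hi
  exact hi.not_ge (sub_mul_sub_nonpos_of_complementary (hy.1 i) (hsol.1 i) (hy.2.1 i)
    (hsol.2.1 i) (hy.mul_eq_zero i) (hsol.mul_eq_zero i))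
end

section
/- Let M be a real n×n matrix such that for every vector q ∈ ℝⁿ the linear complementarity problem LCP(M, q) has exactly one solution. Then M is a P-matrix, i.e. all of its principal minors are positive. -/
open scoped Matrix

/-- The matrix with the columns of `M` indexed by `J`, and the columns of the identity matrix
elsewhere. -/
def complementaryMatrix {n : ℕ} (M : Matrix (Fin n) (Fin n) ℝ) (J : Finset (Fin n)) :
    Matrix (Fin n) (Fin n) ℝ :=
  Matrix.of fun i j => if j ∈ J then M i j else (1 : Matrix (Fin n) (Fin n) ℝ) i j

theorem det_complementaryMatrix {n : ℕ} (M : Matrix (Fin n) (Fin n) ℝ) (J : Finset (Fin n)) :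
    (complementaryMatrix M J).det =
      (M.submatrix (fun j : J => (j : Fin n)) (fun j : J => (j : Fin n))).det := by
  rw [Matrix.twoBlockTriangular_det' (complementaryMatrix M J) (fun i => i ∈ J)]
  · have h₁ : (complementaryMatrix M J).toSquareBlockProp (fun i => i ∈ J) =
        M.submatrix (fun j : J => (j : Fin n)) (fun j : J => (j : Fin n)) := by
      ext i j
      simp [complementaryMatrix, Matrix.toSquareBlockProp]
    have h₂ : (complementaryMatrix M J).toSquareBlockProp (fun i => ¬ i ∈ J) = 1 := by
      ext i j
      simp [complementaryMatrix, Matrix.toSquareBlockProp, j.2, Matrix.one_apply, Subtype.ext_iff]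
    rw [h₁, h₂, Matrix.det_one, mul_one]
    congr!
  · intro i hi j hj
    have hij : i ≠ j := fun h => hj (h ▸ hi)
    simp [complementaryMatrix, hj, hij]

theorem complementaryMatrix_mulVec {n : ℕ} (M : Matrix (Fin n) (Fin n) ℝ) (J : Finset (Fin n))
    (c : Fin n → ℝ) :
    complementaryMatrix M J *ᵥ c =
      M *ᵥ (fun i => if i ∈ J then c i else 0) + fun i => if i ∈ J then 0 else c i := by
  ext i
  have h : (if i ∈ J then 0 else c i) = ∑ j, if j ∈ J then 0 else if i = j then c j else 0 := by
    rw [Finset.sum_eq_single i]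
    · simp
    · intro j _ hj
      simp [hj.symm]
    · simp
  simp only [Matrix.mulVec, dotProduct, Pi.add_apply, h, ← Finset.sum_add_distrib]
  refine Finset.sum_congr rfl fun j _ => ?_
  by_cases hj : j ∈ J <;> simp [complementaryMatrix, hj, Matrix.one_apply]

theorem updateCol_complementaryMatrix {n : ℕ} (M : Matrix (Fin n) (Fin n) ℝ)
    (J : Finset (Fin n)) (k : Fin n) :
    (complementaryMatrix M J).updateCol k (M.col k) = complementaryMatrix M (insert k J) := by
  ext i j
  by_cases hj : j = k
  · subst hj
    simp [complementaryMatrix]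
  · simp [complementaryMatrix, hj]

/-- If all problems `LCP(M, q)` have at most one solution, adjoining an index preserves positivity
of the complementary determinants. -/
theorem det_complementaryMatrix_insert_pos {n : ℕ} {M : Matrix (Fin n) (Fin n) ℝ}
    (h : ∀ q x y : Fin n → ℝ, IsLCPSol M q x → IsLCPSol M q y → x = y)
    {J : Finset (Fin n)} {k : Fin n} (hk : k ∉ J) (hJ : 0 < (complementaryMatrix M J).det) :
    0 < (complementaryMatrix M (insert k J)).det := by
  by_contra! hneg
  set d := (complementaryMatrix M J).det
  set c := (complementaryMatrix M J).cramer (M.col k)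
  have hck : c k ≤ 0 := by
    rwa [← updateCol_complementaryMatrix, ← Matrix.cramer_apply] at hneg
  have hc : M *ᵥ (fun i => if i ∈ J then c i else 0) + (fun i => if i ∈ J then 0 else c i) =
      d • M.col k := by
    rw [← complementaryMatrix_mulVec, Matrix.mulVec_cramer]
  let x : Fin n → ℝ := fun i => if i ∈ J then |c i| + c i else 0
  let y : Fin n → ℝ := fun i => if i ∈ J then |c i| else if i = k then d else 0
  let u : Fin n → ℝ := fun i => if i ∈ J then 0 else if i = k then 0 else |c i|
  let w : Fin n → ℝ := fun i => u i - if i ∈ J then 0 else c i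
  have hxy : x + Pi.single k d = y + fun i => if i ∈ J then c i else 0 := by
    ext i
    by_cases hi : i ∈ J
    · have hik : i ≠ k := fun e => hk (e ▸ hi)
      simp [x, y, hi, hik]
    · by_cases hik : i = k <;> simp [x, y, hi, hik, hk]
  have hy : M *ᵥ y + (u - M *ᵥ y) = u := by abel
  have hx : M *ᵥ x + (u - M *ᵥ y) = w := by
    have hM := congrArg (M *ᵥ ·) hxy
    simp only [Matrix.mulVec_add, Matrix.mulVec_single] at hM
    ext i
    have h₁ := congrFun hM i
    have h₂ := congrFun hc i
    simp only [Pi.add_apply, Pi.sub_apply, Pi.smul_apply, smul_eq_mul, op_smul_eq_smul, w]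
      at h₁ h₂ ⊢
    linarith
  have hsol_y : IsLCPSol M (u - M *ᵥ y) y := by
    unfold IsLCPSol
    rw [hy]
    refine ⟨fun i => ?_, fun i => ?_, Finset.sum_eq_zero fun i _ => ?_⟩
    · dsimp only [y]
      split_ifs <;> positivity
    · dsimp only [u]
      split_ifs <;> positivity
    · dsimp only [y, u]
      split_ifs <;> simp
  have hsol_x : IsLCPSol M (u - M *ᵥ y) x := by
    unfold IsLCPSol
    rw [hx]
    refine ⟨fun i => ?_, fun i => ?_, Finset.sum_eq_zero fun i _ => ?_⟩
    · dsimp only [x]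
      split_ifs
      · linarith [neg_abs_le (c i)]
      · exact le_rfl
    · dsimp only [w, u]
      split_ifs with h₁ h₂
      · simp
      · subst h₂
        linarith
      · linarith [le_abs_self (c i)]
    · dsimp only [x, w, u]
      split_ifs <;> simp
  have hne := congrFun (h _ _ _ hsol_x hsol_y) k
  simp only [x, y, hk, if_false, if_true] at hne
  exact hJ.ne hne

/-- If for every `q` the problem `LCP(M, q)` has exactly one solution, then `M` is a
P-matrix. -/
theorem stmt_6 {n : ℕ} (M : Matrix (Fin n) (Fin n) ℝ)
    (h : ∀ q : Fin n → ℝ, ∃! x : Fin n → ℝ, IsLCPSol M q x) :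
    IsPMatrix M := by
  intro J hJ
  rw [← det_complementaryMatrix]
  clear hJ
  induction J using Finset.induction_on with
  | empty => simp [det_complementaryMatrix]
  | insert k J hk ih =>
    exact det_complementaryMatrix_insert_pos (fun q _ _ => (h q).unique) hk ih
end
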